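/- arXiv:1307.4265 — 2 statements merged into one kernel-verified Lean document; each statement's English description precedes it below -/
import Mathlib

section
/- Let A and B be Hermitian n×n complex matrices (n ≥ 1). Then min over density matrices ρ of max{ Tr(ρA), Tr(ρB) } equals max over p ∈ [0,1] of λ_min( pA + (1−p)B ), where λ_min denotes the smallest eigenvalue of a Hermitian matrix; in particular both the minimum over ρ and the maximum over p are attained. -/
open scoped ComplexOrder

/-- Smallest eigenvalue of a Hermitian matrix (junk value `0` otherwise). -/
noncomputable def lambdaMin {n : ℕ} (M : Matrix (Fin n) (Fin n) ℂ) : ℝ :=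
  if h : M.IsHermitian then ⨅ i, h.eigenvalues i else 0

/-- The set of density matrices indexed by `m`: positive semidefinite matrices of trace one. -/
def densityMatrices (m : Type*) [Fintype m] : Set (Matrix m m ℂ) :=
  {ρ | ρ.PosSemidef ∧ ρ.trace = 1}

open scoped MatrixOrder in
theorem Matrix.PosSemidef.exists_eq_conjTranspose_mul_self
    {m : Type*} [Fintype m] [DecidableEq m] {M : Matrix m m ℂ}
    (hM : M.PosSemidef) : ∃ C : Matrix m m ℂ, M = C.conjTranspose * C :=
  CStarAlgebra.nonneg_iff_eq_star_mul_self.mp hM.nonneg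

theorem Matrix.PosSemidef.trace_mul_nonneg {m : Type*} [Fintype m] [DecidableEq m]
    {M N : Matrix m m ℂ} (hM : M.PosSemidef)
    (hN : N.PosSemidef) : 0 ≤ (M * N).trace := by
  obtain ⟨C, rfl⟩ := hM.exists_eq_conjTranspose_mul_self
  rw [Matrix.mul_assoc, Matrix.trace_mul_comm]
  exact (hN.mul_mul_conjTranspose_same C).trace_nonneg

theorem Matrix.IsHermitian.posSemidef_sub_smul_one {m : Type*} [Fintype m] [DecidableEq m]
    {M : Matrix m m ℂ} (hM : M.IsHermitian)
    {c : ℝ} (hc : ∀ i, c ≤ hM.eigenvalues i) : (M - (c : ℂ) • 1).PosSemidef := by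
  have h1 : (1 : Matrix m m ℂ) =
      Unitary.conjStarAlgAut ℂ (Matrix m m ℂ) hM.eigenvectorUnitary 1 := by simp
  rw [hM.spectral_theorem, h1, ← map_smul, ← map_sub, Unitary.conjStarAlgAut_apply,
    Matrix.IsUnit.posSemidef_star_right_conjugate_iff (Unitary.isUnit_coe), ← Matrix.diagonal_one,
    ← Matrix.diagonal_smul, Matrix.diagonal_sub, Matrix.posSemidef_diagonal_iff]
  intro i
  simpa using hc i

theorem isCompact_densityMatrices {m : Type*} [Fintype m] [DecidableEq m] :
    IsCompact (densityMatrices m) := by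
  have hpi : IsCompact {C : m → m → ℂ | ∀ i j, C i j ∈ Metric.closedBall (0 : ℂ) 1} := by
    have h := isCompact_univ_pi (X := fun _ : m => m → ℂ) fun _ =>
      isCompact_univ_pi (X := fun _ : m => ℂ) fun _ => isCompact_closedBall (0 : ℂ) 1
    convert! h using 1
    ext C
    simp [Set.mem_pi]
  have hbox : IsCompact {C : Matrix m m ℂ | ∀ i j, C i j ∈ Metric.closedBall (0 : ℂ) 1} := hpi
  have hclosed : IsClosed {C : Matrix m m ℂ | (C.conjTranspose * C).trace = 1} :=
    isClosed_eq (by fun_prop) continuous_const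
  have hsub : {C : Matrix m m ℂ | (C.conjTranspose * C).trace = 1} ⊆
      {C : Matrix m m ℂ | ∀ i j, C i j ∈ Metric.closedBall (0 : ℂ) 1} := by
    intro C hC i j
    have hsum : ∑ j, ∑ i, ‖C i j‖ ^ 2 = 1 := by
      have hC' : (C.conjTranspose * C).trace = 1 := hC
      simp only [Matrix.trace, Matrix.diag, Matrix.mul_apply, Matrix.conjTranspose_apply,
        RCLike.star_def, RCLike.conj_mul] at hC'
      apply_fun Complex.re at hC'
      simpa [← Complex.ofReal_pow] using hC'
    have hle : ‖C i j‖ ^ 2 ≤ 1 := by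
      rw [← hsum]
      exact (Finset.single_le_sum (f := fun i => ‖C i j‖ ^ 2) (fun _ _ => by positivity)
        (Finset.mem_univ i)).trans
        (Finset.single_le_sum (f := fun j => ∑ i, ‖C i j‖ ^ 2) (fun _ _ => by positivity)
        (Finset.mem_univ j))
    rw [mem_closedBall_zero_iff]
    exact (sq_le_one_iff₀ (norm_nonneg _)).mp hle
  have himage : densityMatrices m = (fun C : Matrix m m ℂ => C.conjTranspose * C) ''
      {C : Matrix m m ℂ | (C.conjTranspose * C).trace = 1} := by
    ext ρ
    constructor
    · rintro ⟨hρ, htr⟩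
      obtain ⟨C, rfl⟩ := hρ.exists_eq_conjTranspose_mul_self
      exact ⟨C, htr, rfl⟩
    · rintro ⟨C, hC, rfl⟩
      exact ⟨Matrix.posSemidef_conjTranspose_mul_self C, hC⟩
  rw [himage]
  exact (hbox.of_isClosed_subset hclosed hsub).image (by fun_prop)

theorem convex_densityMatrices {m : Type*} [Fintype m] : Convex ℝ (densityMatrices m) := by
  rintro ρ ⟨hρ, hρ1⟩ σ ⟨hσ, hσ1⟩ a b ha hb hab
  refine ⟨(hρ.smul ha).add (hσ.smul hb), ?_⟩
  rw [Matrix.trace_add, Matrix.trace_smul, Matrix.trace_smul, hρ1, hσ1, ← add_smul, hab, one_smul]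

theorem Matrix.IsHermitian.exists_density_trace_eq_eigenvalues
    {m : Type*} [Fintype m] [DecidableEq m] {M : Matrix m m ℂ}
    (hM : M.IsHermitian) (i : m) :
    ∃ ρ ∈ densityMatrices m, (ρ * M).trace.re = hM.eigenvalues i := by
  have hunit : (⇑(hM.eigenvectorBasis i) : m → ℂ) ⬝ᵥ star ⇑(hM.eigenvectorBasis i) = 1 := by
    rw [← EuclideanSpace.inner_eq_star_dotProduct, inner_self_eq_norm_sq_to_K]
    simp
  refine ⟨Matrix.vecMulVec (hM.eigenvectorBasis i) (star ⇑(hM.eigenvectorBasis i)),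
    ⟨Matrix.posSemidef_vecMulVec_self_star (R := ℂ) _, ?_⟩, ?_⟩
  · rw [Matrix.trace_vecMulVec, hunit]
  · rw [Matrix.trace_mul_comm, Matrix.mul_vecMulVec, hM.mulVec_eigenvectorBasis,
      Matrix.trace_vecMulVec, smul_dotProduct, hunit]
    simp

theorem lambdaMin_le_trace_mul {n : ℕ} {M ρ : Matrix (Fin n) (Fin n) ℂ} (hM : M.IsHermitian)
    (hρ : ρ ∈ densityMatrices (Fin n)) : lambdaMin M ≤ (ρ * M).trace.re := by
  have hle : ∀ i, lambdaMin M ≤ hM.eigenvalues i := fun i => by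
    rw [lambdaMin, dif_pos hM]
    exact ciInf_le (Set.finite_range _).bddBelow i
  have h := (hρ.1.trace_mul_nonneg (hM.posSemidef_sub_smul_one hle))
  rw [Matrix.mul_sub, Matrix.trace_sub, Matrix.mul_smul, Matrix.mul_one, Matrix.trace_smul,
    hρ.2] at h
  simpa using (Complex.le_def.mp h).1

theorem exists_density_trace_mul_eq_lambdaMin {n : ℕ} [Nonempty (Fin n)]
    {M : Matrix (Fin n) (Fin n) ℂ} (hM : M.IsHermitian) :
    ∃ ρ ∈ densityMatrices (Fin n), (ρ * M).trace.re = lambdaMin M := by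
  obtain ⟨i, hi⟩ := exists_eq_ciInf_of_finite (f := hM.eigenvalues)
  rw [lambdaMin, dif_pos hM, ← hi]
  exact hM.exists_density_trace_eq_eigenvalues i

theorem re_trace_mul_smul_add_smul {m : Type*} [Fintype m] (ρ A B : Matrix m m ℂ) (s t : ℝ) :
    (ρ * (s • A + t • B)).trace.re = s * (ρ * A).trace.re + t * (ρ * B).trace.re := by
  simp [Matrix.mul_add]

/-- Minimax: for Hermitian `A`, `B`, the minimum over density matrices `ρ` of
`max {Tr(ρA), Tr(ρB)}` equals the maximum over `p ∈ [0,1]` of `λ_min(pA + (1−p)B)`,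
and both optima are attained. -/
theorem stmt_7 {n : ℕ} (hn : 1 ≤ n) (A B : Matrix (Fin n) (Fin n) ℂ)
    (hA : A.IsHermitian) (hB : B.IsHermitian) :
    ∃ ρ : Matrix (Fin n) (Fin n) ℂ, ρ.PosSemidef ∧ ρ.trace = 1 ∧
      ∃ p : ℝ, p ∈ Set.Icc (0 : ℝ) 1 ∧
        (∀ ρ' : Matrix (Fin n) (Fin n) ℂ, ρ'.PosSemidef → ρ'.trace = 1 →
          max ((ρ * A).trace.re) ((ρ * B).trace.re) ≤
            max ((ρ' * A).trace.re) ((ρ' * B).trace.re)) ∧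
        (∀ q ∈ Set.Icc (0 : ℝ) 1,
          lambdaMin (q • A + (1 - q) • B) ≤ lambdaMin (p • A + (1 - p) • B)) ∧
        max ((ρ * A).trace.re) ((ρ * B).trace.re) = lambdaMin (p • A + (1 - p) • B) := by
  have : Nonempty (Fin n) := ⟨⟨0, hn⟩⟩
  have hherm : ∀ q : ℝ, (q • A + (1 - q) • B).IsHermitian := fun q =>
    (hA.smul (IsSelfAdjoint.all q)).add (hB.smul (IsSelfAdjoint.all (1 - q)))
  have hweak : ∀ ρ ∈ densityMatrices (Fin n), ∀ q ∈ Set.Icc (0 : ℝ) 1,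
      lambdaMin (q • A + (1 - q) • B) ≤ max ((ρ * A).trace.re) ((ρ * B).trace.re) := by
    intro ρ hρ q hq
    refine (lambdaMin_le_trace_mul (hherm q) hρ).trans ?_
    rw [re_trace_mul_smul_add_smul]
    nlinarith [mul_le_mul_of_nonneg_left (le_max_left (ρ * A).trace.re (ρ * B).trace.re) hq.1,
      mul_le_mul_of_nonneg_left (le_max_right (ρ * A).trace.re (ρ * B).trace.re)
        (sub_nonneg.mpr hq.2)]
  obtain ⟨ρ, hρ, p, hp, hsaddle⟩ := Sion.exists_isSaddlePointOn
    (X := densityMatrices (Fin n)) (Y := Set.Icc (0 : ℝ) 1)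
    (f := fun ρ q => (ρ * (q • A + (1 - q) • B)).trace.re)
    (let ⟨ρ, hρ, _⟩ := exists_density_trace_mul_eq_lambdaMin hA; ⟨ρ, hρ⟩)
    convex_densityMatrices isCompact_densityMatrices
    (fun q _ => Continuous.lowerSemicontinuous (by fun_prop) |>.lowerSemicontinuousOn _)
    (fun q _ => ConvexOn.quasiconvexOn
      ⟨convex_densityMatrices, fun ρ _ σ _ a b _ _ _ => by simp [Matrix.add_mul]⟩)
    (convex_Icc 0 1) ⟨0, by simp⟩ isCompact_Icc
    (fun ρ _ => Continuous.upperSemicontinuous (by fun_prop) |>.upperSemicontinuousOn _)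
    (fun ρ _ => ConcaveOn.quasiconcaveOn
      ⟨convex_Icc 0 1, fun q _ r _ a b _ _ hab => by
        simp only [re_trace_mul_smul_add_smul, smul_eq_mul]
        obtain rfl : b = 1 - a := by linarith
        exact le_of_eq (by ring)⟩)
  obtain ⟨σ, hσ, hσp⟩ := exists_density_trace_mul_eq_lambdaMin (hherm p)
  have hstrong : max ((ρ * A).trace.re) ((ρ * B).trace.re) ≤
      lambdaMin (p • A + (1 - p) • B) := by
    rw [← hσp]
    exact max_le (by simpa using hsaddle σ hσ 1 (by simp)) (by simpa using hsaddle σ hσ 0 (by simp))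
  exact ⟨ρ, hρ.1, hρ.2, p, hp, fun ρ' h h' => hstrong.trans (hweak ρ' ⟨h, h'⟩ p hp),
    fun q hq => (hweak ρ hρ q hq).trans hstrong, hstrong.antisymm (hweak ρ hρ p hp)⟩
end

section
/- Let {X_j}_{j∈J} and {Z_k}_{k∈K} be POVMs on ℂ^n. Let Y be a nonempty finite set and let {ρ^y}_{y∈Y} be positive semidefinite n×n complex matrices with ∑_{y∈Y} Tr(ρ^y) = 1. Define the joint probability distributions P^X(j,y) = Tr(X_j ρ^y) on J×Y and P^Z(k,y) = Tr(Z_k ρ^y) on K×Y, with classical mutual informations I(X:Y) and I(Z:Y). Set h_j(X,Z) = ‖∑_{k∈K} Z_k X_j Z_k‖ and h_k(Z,X) = ‖∑_{j∈J} X_j Z_k X_j‖. Then I(X:Y) + I(Z:Y) ≤ min{ log₂( |K| · ∑_{j∈J} h_j(X,Z) ), log₂( |J| · ∑_{k∈K} h_k(Z,X) ) }, where |J| and |K| denote the number of POVM elements. -/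
open scoped ComplexOrder BigOperators

/-- The ℓ²→ℓ² operator norm (largest singular value) of a complex matrix. -/
noncomputable def opNorm {n : ℕ} (M : Matrix (Fin n) (Fin n) ℂ) : ℝ :=
  ‖Matrix.toEuclideanCLM (𝕜 := ℂ) M‖

/-- Classical mutual information (base 2) of a finitely supported joint distribution,
with the convention that terms with `P a b = 0` vanish. -/
noncomputable def mutualInfo {A B : Type*} [Fintype A] [Fintype B] (P : A → B → ℝ) : ℝ :=
  ∑ a, ∑ b, P a b * Real.logb 2 (P a b / ((∑ b', P a b') * (∑ a', P a' b)))

/-- The real-linear functional `M ↦ Re Tr(M σ)`. -/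
noncomputable def reTrace {n : ℕ} (σ : Matrix (Fin n) (Fin n) ℂ) :
    Matrix (Fin n) (Fin n) ℂ →ₗ[ℝ] ℝ where
  toFun M := (M * σ).trace.re
  map_add' A B := by simp [add_mul]
  map_smul' c A := by simp

section Quantum

open Matrix

variable {n : ℕ} {σ : Matrix (Fin n) (Fin n) ℂ}

lemma reTrace_apply (M : Matrix (Fin n) (Fin n) ℂ) : reTrace σ M = (M * σ).trace.re := rfl

lemma reTrace_smul_left (r : ℝ) (M : Matrix (Fin n) (Fin n) ℂ) :
    reTrace (r • σ) M = r * reTrace σ M := by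
  simp [reTrace_apply]

open scoped MatrixOrder Norms.L2Operator in
lemma exists_eq_star_mul_self (hσ : σ.PosSemidef) :
    ∃ S : Matrix (Fin n) (Fin n) ℂ, σ = star S * S :=
  CStarAlgebra.nonneg_iff_eq_star_mul_self.mp hσ.nonneg

lemma reTrace_conj_nonneg (hσ : σ.PosSemidef) {A : Matrix (Fin n) (Fin n) ℂ}
    (hA : A.PosSemidef) (B : Matrix (Fin n) (Fin n) ℂ) :
    0 ≤ reTrace σ (Bᴴ * A * B) := by
  obtain ⟨S, rfl⟩ := exists_eq_star_mul_self hσ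
  have h : (Bᴴ * A * B * (star S * S)).trace = ((B * Sᴴ)ᴴ * A * (B * Sᴴ)).trace := by
    rw [← mul_assoc, trace_mul_comm, star_eq_conjTranspose]
    simp only [conjTranspose_mul, conjTranspose_conjTranspose, mul_assoc]
  rw [reTrace_apply, h]
  exact (Complex.le_def.mp (hA.conjTranspose_mul_mul_same _).trace_nonneg).1

lemma reTrace_nonneg (hσ : σ.PosSemidef) {A : Matrix (Fin n) (Fin n) ℂ}
    (hA : A.PosSemidef) : 0 ≤ reTrace σ A := by
  simpa using reTrace_conj_nonneg hσ hA 1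

lemma reTrace_mul_comm (hσ : σ.IsHermitian) {A B : Matrix (Fin n) (Fin n) ℂ}
    (hA : A.IsHermitian) (hB : B.IsHermitian) :
    reTrace σ (A * B) = reTrace σ (B * A) := by
  have h : (A * B * σ)ᴴ = σ * (B * A) := by
    simp only [conjTranspose_mul, hσ.eq, hA.eq, hB.eq]
  have h' := congrArg (fun M => (trace M).re) h
  simp only [trace_conjTranspose, Complex.star_def, Complex.conj_re] at h'
  rw [reTrace_apply, reTrace_apply, h', trace_mul_comm]

lemma two_mul_reTrace_mul_le (hσ : σ.PosSemidef) {A B : Matrix (Fin n) (Fin n) ℂ}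
    (hA : A.PosSemidef) (hB : B.IsHermitian) (c d : ℝ) :
    2 * (c * d) * reTrace σ (A * B) ≤ c ^ 2 * reTrace σ (B * A * B) + d ^ 2 * reTrace σ A := by
  have h := reTrace_conj_nonneg hσ hA (c • B - d • 1)
  have e : (c • B - d • 1)ᴴ * A * (c • B - d • 1) =
      (c ^ 2) • (B * A * B) - (c * d) • (B * A) - (c * d) • (A * B) + (d ^ 2) • A := by
    simp only [conjTranspose_sub, conjTranspose_smul, hB.eq, conjTranspose_one, star_trivial,
      sub_mul, mul_sub, smul_mul_assoc, mul_smul_comm, one_mul, mul_one, smul_sub, smul_smul,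
      pow_two, mul_comm d c]
    abel
  rw [e] at h
  simp only [map_add, map_sub, map_smul, smul_eq_mul] at h
  rw [reTrace_mul_comm hσ.isHermitian hB hA.isHermitian] at h
  linarith

lemma two_mul_sum_reTrace_mul_le {J : Type*} [Fintype J] (hσ : σ.PosSemidef)
    {X : J → Matrix (Fin n) (Fin n) ℂ} (hX : ∀ j, (X j).PosSemidef) (hX1 : ∑ j, X j = 1)
    {E : Matrix (Fin n) (Fin n) ℂ} (hE : E.IsHermitian) (c : J → ℝ) :
    2 * ∑ j, c j * reTrace σ (X j * E) ≤
      ∑ j, c j ^ 2 * reTrace σ (X j) + reTrace σ (E * E) := by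
  have hEE : reTrace σ (E * E) = ∑ j, reTrace σ (E * X j * E) := by
    rw [← map_sum, ← Finset.sum_mul, ← Finset.mul_sum, hX1, mul_one]
  rw [hEE, Finset.mul_sum, ← Finset.sum_add_distrib]
  refine Finset.sum_le_sum fun j _ => ?_
  linarith [two_mul_reTrace_mul_le hσ (hX j) hE 1 (c j)]

lemma sum_smul_isHermitian {K : Type*} [Fintype K] {Z : K → Matrix (Fin n) (Fin n) ℂ}
    (hZ : ∀ k, (Z k).IsHermitian) (e : K → ℝ) : (∑ k, e k • Z k).IsHermitian :=
  isSelfAdjoint_sum _ fun k _ => by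
    simp only [IsSelfAdjoint, star_smul, star_trivial, star_eq_conjTranspose, (hZ k).eq]

/-- The Kadison inequality for the positive unital map `e ↦ ∑ k, e k • Z k`. -/
lemma reTrace_sum_smul_mul_self_le {K : Type*} [Fintype K] (hσ : σ.PosSemidef)
    {Z : K → Matrix (Fin n) (Fin n) ℂ} (hZ : ∀ k, (Z k).PosSemidef) (hZ1 : ∑ k, Z k = 1)
    (e : K → ℝ) :
    reTrace σ ((∑ k, e k • Z k) * ∑ k, e k • Z k) ≤ ∑ k, e k ^ 2 * reTrace σ (Z k) := by
  set E := ∑ k, e k • Z k with hE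
  have h := two_mul_sum_reTrace_mul_le hσ hZ hZ1
    (sum_smul_isHermitian (fun k => (hZ k).isHermitian) e) e
  have h' : ∑ k, e k * reTrace σ (Z k * E) = reTrace σ (E * E) := by
    rw [show E * E = ∑ k, e k • (Z k * E) by
      conv_lhs => enter [1]; rw [hE]
      simp only [Finset.sum_mul, smul_mul_assoc]]
    simp only [map_sum, map_smul, smul_eq_mul]
  rw [← hE, h'] at h
  linarith

lemma reTrace_le_opNorm (hσ : σ.PosSemidef) (M : Matrix (Fin n) (Fin n) ℂ) :
    reTrace σ M ≤ opNorm M * σ.trace.re := by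
  obtain ⟨S, rfl⟩ := exists_eq_star_mul_self hσ
  have h1 : reTrace (star S * S) M =
      ∑ i, (inner ℂ (WithLp.toLp 2 (star (S i)))
        (toEuclideanCLM (𝕜 := ℂ) M (WithLp.toLp 2 (star (S i))))).re := by
    rw [reTrace_apply, ← mul_assoc, trace_mul_comm, trace, Complex.re_sum]
    refine Finset.sum_congr rfl fun i _ => ?_
    rw [toEuclideanCLM_toLp, EuclideanSpace.inner_toLp_toLp]
    simp only [diag_apply, mul_apply, dotProduct, mulVec, star_eq_conjTranspose,
      conjTranspose_apply, Pi.star_apply, star_star]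
    refine congrArg _ (Finset.sum_congr rfl fun a _ => mul_comm _ _)
  have h2 : (star S * S).trace.re =
      ∑ i, ‖(WithLp.toLp 2 (star (S i)) : EuclideanSpace ℂ (Fin n))‖ ^ 2 := by
    rw [trace_mul_comm, trace, Complex.re_sum]
    refine Finset.sum_congr rfl fun i _ => ?_
    rw [EuclideanSpace.norm_sq_eq]
    simp only [diag_apply, mul_apply, star_eq_conjTranspose, conjTranspose_apply, Complex.re_sum,
      Pi.star_apply, norm_star]
    refine Finset.sum_congr rfl fun a _ => ?_
    rw [Complex.star_def, Complex.mul_conj, Complex.normSq_eq_norm_sq, Complex.ofReal_re]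
  rw [h1, h2, Finset.mul_sum]
  refine Finset.sum_le_sum fun i _ => ?_
  set x : EuclideanSpace ℂ (Fin n) := WithLp.toLp 2 (star (S i))
  calc (inner ℂ x (toEuclideanCLM (𝕜 := ℂ) M x)).re
      ≤ ‖x‖ * ‖toEuclideanCLM (𝕜 := ℂ) M x‖ :=
        (Complex.re_le_norm _).trans (norm_inner_le_norm _ _)
    _ ≤ ‖x‖ * (‖toEuclideanCLM (𝕜 := ℂ) M‖ * ‖x‖) := by
        gcongr; exact ContinuousLinearMap.le_opNorm _ _
    _ = opNorm M * ‖x‖ ^ 2 := by rw [opNorm]; ring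

lemma opNorm_nonneg (M : Matrix (Fin n) (Fin n) ℂ) : 0 ≤ opNorm M := norm_nonneg _

lemma sum_reTrace_eq_trace {J : Type*} [Fintype J] {X : J → Matrix (Fin n) (Fin n) ℂ}
    (hX1 : ∑ j, X j = 1) : ∑ j, reTrace σ (X j) = σ.trace.re := by
  rw [← map_sum, hX1, reTrace_apply, one_mul]

/-- Resolvent form of the POVM entropic uncertainty relation. -/
lemma sum_sq_div_le_sum_div {J K : Type*} [Fintype J] [Fintype K] (hσ : σ.PosSemidef)
    (hσ1 : σ.trace.re = 1)
    {X : J → Matrix (Fin n) (Fin n) ℂ} {Z : K → Matrix (Fin n) (Fin n) ℂ}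
    (hX : ∀ j, (X j).PosSemidef) (hX1 : ∑ j, X j = 1)
    (hZ : ∀ k, (Z k).PosSemidef) (hZ1 : ∑ k, Z k = 1) {t : ℝ} (ht : 0 < t) :
    ∑ j, reTrace σ (X j) ^ 2 / (opNorm (∑ k, Z k * X j * Z k) + t * reTrace σ (X j)) ≤
      ∑ k, reTrace σ (Z k) / (reTrace σ (Z k) + t) := by
  set p : J → ℝ := fun j => reTrace σ (X j) with hp
  set q : K → ℝ := fun k => reTrace σ (Z k) with hq
  set h : J → ℝ := fun j => opNorm (∑ k, Z k * X j * Z k) with hh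
  have hp0 : ∀ j, 0 ≤ p j := fun j => reTrace_nonneg hσ (hX j)
  have hq0 : ∀ k, 0 ≤ q k := fun k => reTrace_nonneg hσ (hZ k)
  have hh0 : ∀ j, 0 ≤ h j := fun j => opNorm_nonneg _
  have hp1 : ∑ j, p j = 1 := (sum_reTrace_eq_trace hX1).trans hσ1
  set c : J → ℝ := fun j => p j / (h j + t * p j) with hc
  set e : K → ℝ := fun k => 1 / (q k + t) with he
  set d : K → ℝ := fun k => q k / (q k + t) with hd
  set b : K → ℝ := fun k => ∑ j, c j * reTrace σ (X j * Z k) with hb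
  have hcb : ∑ j, c j * p j = ∑ k, b k := by
    rw [hb, Finset.sum_comm]
    refine Finset.sum_congr rfl fun j _ => ?_
    rw [← Finset.mul_sum, ← map_sum, ← Finset.mul_sum, hZ1, mul_one]
  have hh1 : ∑ k, (2 * d k * b k - d k ^ 2) ≤ ∑ j, c j ^ 2 * h j := by
    calc ∑ k, (2 * d k * b k - d k ^ 2)
        ≤ ∑ k, ∑ j, c j ^ 2 * reTrace σ (Z k * X j * Z k) := by
          refine Finset.sum_le_sum fun k _ => ?_
          have hd2 : d k ^ 2 = ∑ j, d k ^ 2 * p j := by rw [← Finset.mul_sum, hp1, mul_one]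
          rw [hd2, hb, Finset.mul_sum, ← Finset.sum_sub_distrib]
          refine Finset.sum_le_sum fun j _ => ?_
          linarith [two_mul_reTrace_mul_le hσ (hX j) (hZ k).isHermitian (c j) (d k)]
      _ = ∑ j, c j ^ 2 * reTrace σ (∑ k, Z k * X j * Z k) := by
          rw [Finset.sum_comm]
          simp only [map_sum, Finset.mul_sum]
      _ ≤ ∑ j, c j ^ 2 * h j := by
          gcongr with j
          simpa [hσ1] using reTrace_le_opNorm hσ (∑ k, Z k * X j * Z k)
  have hh2 : ∑ k, (2 * e k * b k - e k ^ 2 * q k) ≤ ∑ j, c j ^ 2 * p j := by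
    have h1 := two_mul_sum_reTrace_mul_le hσ hX hX1
      (sum_smul_isHermitian (fun k => (hZ k).isHermitian) e) c
    have h2 := reTrace_sum_smul_mul_self_le hσ hZ hZ1 e
    have h3 : ∑ j, c j * reTrace σ (X j * ∑ k, e k • Z k) = ∑ k, e k * b k := by
      simp only [hb, Finset.mul_sum, map_sum, mul_smul_comm, map_smul, smul_eq_mul]
      rw [Finset.sum_comm]
      exact Finset.sum_congr rfl fun k _ => Finset.sum_congr rfl fun j _ => by ring
    rw [h3] at h1
    rw [Finset.sum_sub_distrib]
    simp only [mul_assoc, ← Finset.mul_sum]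
    linarith
  have hl : ∀ j, p j ^ 2 / (h j + t * p j) =
      2 * (c j * p j) - c j ^ 2 * h j - t * (c j ^ 2 * p j) := by
    intro j
    simp only [hc]
    rcases eq_or_ne (h j + t * p j) 0 with h0 | h0
    · simp [h0]
    · linear_combination (p j / (h j + t * p j)) * div_mul_cancel₀ (p j) h0
  have hr : ∀ k, q k / (q k + t) =
      2 * b k - (2 * d k * b k - d k ^ 2) - t * (2 * e k * b k - e k ^ 2 * q k) := by
    intro k
    simp only [hd, he]
    have : q k + t ≠ 0 := (add_pos_of_nonneg_of_pos (hq0 k) ht).ne'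
    field_simp
    ring
  rw [Finset.sum_congr rfl fun j _ => hl j, Finset.sum_congr rfl fun k _ => hr k]
  rw [Finset.sum_sub_distrib, Finset.sum_sub_distrib, Finset.sum_sub_distrib,
    Finset.sum_sub_distrib, ← Finset.mul_sum, ← Finset.mul_sum, ← Finset.mul_sum,
    ← Finset.mul_sum, hcb]
  linarith [mul_le_mul_of_nonneg_left hh2 ht.le]

end Quantum

section Classical

open Filter Topology

lemma sum_eq_zero_of_marginal {A B : Type*} [Fintype B] {P : A → B → ℝ}
    (hP : ∀ a b, 0 ≤ P a b) {a : A} (h : ∑ b, P a b = 0) (b : B) : P a b = 0 :=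
  (Finset.sum_eq_zero_iff_of_nonneg fun b _ => hP a b).mp h b (Finset.mem_univ b)

lemma antitoneOn_sum_mul_log_sub {J K : Type*} [Fintype J] [Fintype K]
    {p h : J → ℝ} {q : K → ℝ} (hp : ∀ j, 0 ≤ p j) (hh : ∀ j, 0 ≤ h j) (hq : ∀ k, 0 ≤ q k)
    (hhp : ∀ j, h j = 0 → p j = 0)
    (H : ∀ t : ℝ, 0 < t → ∑ j, p j ^ 2 / (h j + t * p j) ≤ ∑ k, q k / (q k + t)) :
    AntitoneOn (fun t : ℝ => ∑ j, p j * Real.log (h j + t * p j) -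
      ∑ k, q k * Real.log (q k + t)) (Set.Ici 0) := by
  have hpos : ∀ j, p j ≠ 0 → ∀ t : ℝ, 0 ≤ t → 0 < h j + t * p j := fun j hj t ht =>
    add_pos_of_pos_of_nonneg ((hh j).lt_of_ne fun h0 => hj (hhp j h0.symm))
      (mul_nonneg ht (hp j))
  have hderiv : ∀ t : ℝ, 0 < t → HasDerivAt (fun t : ℝ => ∑ j, p j * Real.log (h j + t * p j) -
      ∑ k, q k * Real.log (q k + t))
      (∑ j, p j ^ 2 / (h j + t * p j) - ∑ k, q k / (q k + t)) t := by
    intro t ht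
    refine HasDerivAt.sub (HasDerivAt.fun_sum fun j _ => ?_) (HasDerivAt.fun_sum fun k _ => ?_)
    · rcases eq_or_ne (p j) 0 with hj | hj
      · simpa [hj] using hasDerivAt_const t (0 : ℝ)
      · have := ((((hasDerivAt_id t).mul_const (p j)).const_add (h j)).log
          (hpos j hj t ht.le).ne').const_mul (p j)
        refine this.congr_deriv ?_
        simp only [id]
        ring
    · have := (((hasDerivAt_id t).const_add (q k)).log
        (add_pos_of_nonneg_of_pos (hq k) ht).ne').const_mul (q k)
      refine this.congr_deriv ?_
      simp only [id]
      ring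
  refine antitoneOn_of_deriv_nonpos (convex_Ici 0) ?_ ?_ ?_
  · refine ContinuousOn.sub (continuousOn_finsetSum _ fun j _ => ?_)
      (continuousOn_finsetSum _ fun k _ => ?_)
    · rcases eq_or_ne (p j) 0 with hj | hj
      · simpa [hj] using continuousOn_const
      · exact continuousOn_const.mul (ContinuousOn.log (by fun_prop)
          fun t ht => (hpos j hj t ht).ne')
    · rcases eq_or_ne (q k) 0 with hk | hk
      · simpa [hk] using continuousOn_const
      · exact continuousOn_const.mul (ContinuousOn.log (by fun_prop)
          fun t ht => (add_pos_of_pos_of_nonneg ((hq k).lt_of_ne hk.symm) ht).ne')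
  · rw [interior_Ici]
    exact fun t ht => (hderiv t ht).differentiableAt.differentiableWithinAt
  · rw [interior_Ici]
    intro t ht
    rw [(hderiv t ht).deriv]
    linarith [H t ht]

lemma tendsto_sum_mul_log_sub {J K : Type*} [Fintype J] [Fintype K]
    {p h : J → ℝ} {q : K → ℝ} (hp : ∀ j, 0 ≤ p j) (hh : ∀ j, 0 ≤ h j) (hq : ∀ k, 0 ≤ q k)
    (hp1 : ∑ j, p j = 1) (hq1 : ∑ k, q k = 1) :
    Tendsto (fun t : ℝ => ∑ j, p j * Real.log (h j + t * p j) -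
      ∑ k, q k * Real.log (q k + t)) atTop (𝓝 (∑ j, p j * Real.log (p j))) := by
  have hlim : ∀ a : ℝ, Tendsto (fun t : ℝ => a / t) atTop (𝓝 0) := fun a =>
    tendsto_const_nhds.div_atTop tendsto_id
  have h1 : Tendsto (fun t : ℝ => ∑ j, p j * Real.log (h j / t + p j) -
      ∑ k, q k * Real.log (q k / t + 1)) atTop
      (𝓝 (∑ j, p j * Real.log (p j) - ∑ k, q k * Real.log 1)) := by
    refine Tendsto.sub (tendsto_finsetSum _ fun j _ => ?_) (tendsto_finsetSum _ fun k _ => ?_)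
    · rcases eq_or_ne (p j) 0 with hj | hj
      · simp [hj]
      · refine Tendsto.const_mul _ (Tendsto.log ?_ hj)
        simpa using (hlim (h j)).add_const (p j)
    · refine Tendsto.const_mul _ (Tendsto.log ?_ one_ne_zero)
      simpa using (hlim (q k)).add_const 1
  simp only [Real.log_one, mul_zero, Finset.sum_const_zero, sub_zero] at h1
  refine h1.congr' ?_
  filter_upwards [eventually_gt_atTop 0] with t ht
  have e1 : ∀ j, p j * Real.log (h j / t + p j) =
      p j * Real.log (h j + t * p j) - p j * Real.log t := by
    intro j
    rcases eq_or_ne (p j) 0 with hj | hj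
    · simp [hj]
    · have hpj : 0 < p j := (hp j).lt_of_ne hj.symm
      have : 0 < h j + t * p j := add_pos_of_nonneg_of_pos (hh j) (mul_pos ht hpj)
      rw [show h j / t + p j = (h j + t * p j) / t by field_simp,
        Real.log_div this.ne' ht.ne', mul_sub]
  have e2 : ∀ k, q k * Real.log (q k / t + 1) =
      q k * Real.log (q k + t) - q k * Real.log t := by
    intro k
    have : 0 < q k + t := add_pos_of_nonneg_of_pos (hq k) ht
    rw [show q k / t + 1 = (q k + t) / t by field_simp,
      Real.log_div this.ne' ht.ne', mul_sub]
  simp only [e1, e2, Finset.sum_sub_distrib, ← Finset.sum_mul, hp1, hq1]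
  ring

lemma eq_zero_of_resolvent {J K : Type*} [Fintype J] [Fintype K]
    {p h : J → ℝ} {q : K → ℝ} (hp : ∀ j, 0 ≤ p j) (hh : ∀ j, 0 ≤ h j) (hq : ∀ k, 0 ≤ q k)
    (H : ∀ t : ℝ, 0 < t → ∑ j, p j ^ 2 / (h j + t * p j) ≤ ∑ k, q k / (q k + t))
    (j : J) (hj : h j = 0) : p j = 0 := by
  by_contra hpj
  have hpj : 0 < p j := (hp j).lt_of_ne (Ne.symm hpj)
  set t := p j / (Fintype.card K + 1) with ht
  have ht0 : 0 < t := by positivity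
  have h1 : p j ^ 2 / (h j + t * p j) ≤ ∑ j, p j ^ 2 / (h j + t * p j) :=
    Finset.single_le_sum (f := fun j => p j ^ 2 / (h j + t * p j))
      (fun i _ => div_nonneg (sq_nonneg _)
        (add_nonneg (hh i) (mul_nonneg ht0.le (hp i)))) (Finset.mem_univ j)
  have h2 : ∑ k, q k / (q k + t) ≤ ∑ _k : K, (1 : ℝ) :=
    Finset.sum_le_sum fun k _ => div_le_one_of_le₀ (by linarith) (by linarith [hq k])
  have h3 : p j ^ 2 / (h j + t * p j) = Fintype.card K + 1 := by
    rw [hj, ht]; field_simp; ring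
  have h4 := H t ht0
  simp only [Finset.sum_const, Finset.card_univ, nsmul_eq_mul, mul_one] at h2
  linarith

/-- Integrated form of the resolvent inequality, obtained by letting `t` run from `0` to `∞`. -/
lemma sum_mul_log_le_of_resolvent {J K : Type*} [Fintype J] [Fintype K]
    {p h : J → ℝ} {q : K → ℝ} (hp : ∀ j, 0 ≤ p j) (hh : ∀ j, 0 ≤ h j) (hq : ∀ k, 0 ≤ q k)
    (hp1 : ∑ j, p j = 1) (hq1 : ∑ k, q k = 1)
    (H : ∀ t : ℝ, 0 < t → ∑ j, p j ^ 2 / (h j + t * p j) ≤ ∑ k, q k / (q k + t)) :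
    ∑ j, p j * Real.log (p j) + ∑ k, q k * Real.log (q k) ≤ ∑ j, p j * Real.log (h j) := by
  have hanti := antitoneOn_sum_mul_log_sub hp hh hq (eq_zero_of_resolvent hp hh hq H) H
  have hle := le_of_tendsto (tendsto_sum_mul_log_sub hp hh hq hp1 hq1)
    (by filter_upwards [eventually_ge_atTop 0] with t ht
        exact hanti Set.self_mem_Ici ht ht)
  simp only [zero_mul, add_zero] at hle
  linarith

lemma mutualInfo_eq {A B : Type*} [Fintype A] [Fintype B] {P : A → B → ℝ}
    (hP : ∀ a b, 0 ≤ P a b) {r : B → ℝ} (hr : ∀ b, ∑ a, P a b = r b) :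
    mutualInfo P = (∑ b, ∑ a, P a b * Real.log (P a b) -
      ∑ a, (∑ b, P a b) * Real.log (∑ b, P a b) - ∑ b, r b * Real.log (r b)) / Real.log 2 := by
  have h1 : ∀ a b, P a b * Real.logb 2 (P a b / ((∑ b', P a b') * (∑ a', P a' b))) =
      (P a b * Real.log (P a b) - P a b * Real.log (∑ b', P a b') -
        P a b * Real.log (r b)) / Real.log 2 := by
    intro a b
    rcases eq_or_ne (P a b) 0 with h0 | h0
    · simp [h0]
    · have ha : ∑ b', P a b' ≠ 0 := fun h => h0 (sum_eq_zero_of_marginal hP h b)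
      have hb : ∑ a', P a' b ≠ 0 := fun h =>
        h0 (sum_eq_zero_of_marginal (P := fun b a => P a b) (fun b a => hP a b) h a)
      rw [Real.logb, Real.log_div h0 (mul_ne_zero ha hb), Real.log_mul ha hb, hr b]
      ring
  simp only [mutualInfo, h1, ← Finset.sum_div, Finset.sum_sub_distrib, ← Finset.sum_mul]
  rw [Finset.sum_comm, Finset.sum_comm (f := fun a b => P a b * Real.log (r b))]
  simp only [← Finset.sum_mul, hr]

/-- The Gibbs inequality for unnormalised weights `h`. -/
lemma sum_mul_log_sub_le {J : Type*} [Fintype J] {p h : J → ℝ} (hp : ∀ j, 0 ≤ p j)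
    (hh : ∀ j, 0 ≤ h j) (hp1 : ∑ j, p j = 1) (hhp : ∀ j, h j = 0 → p j = 0) :
    0 < ∑ j, h j ∧
    ∑ j, p j * Real.log (h j) - ∑ j, p j * Real.log (p j) ≤ Real.log (∑ j, h j) := by
  have hS : 0 < ∑ j, h j := by
    refine (Finset.sum_nonneg fun j _ => hh j).lt_of_ne fun h0 => ?_
    have h1 := (Finset.sum_eq_zero_iff_of_nonneg fun j _ => hh j).mp h0.symm
    have h2 : ∑ j, p j = 0 := Finset.sum_eq_zero fun j hj => hhp j (h1 j hj)
    linarith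
  refine ⟨hS, ?_⟩
  set S := ∑ j, h j with hS'
  have hterm : ∀ j, p j * Real.log (h j) - p j * Real.log (p j) - p j * Real.log S ≤
      h j / S - p j := by
    intro j
    rcases eq_or_ne (p j) 0 with hj | hj
    · simpa [hj] using div_nonneg (hh j) hS.le
    · have hpj : 0 < p j := (hp j).lt_of_ne hj.symm
      have hhj : 0 < h j := (hh j).lt_of_ne fun h0 => hj (hhp j h0.symm)
      have h1 := Real.log_le_sub_one_of_pos (x := h j / (p j * S)) (by positivity)
      rw [Real.log_div hhj.ne' (by positivity), Real.log_mul hpj.ne' hS.ne'] at h1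
      have h2 := mul_le_mul_of_nonneg_left h1 hpj.le
      have h3 : p j * (h j / (p j * S) - 1) = h j / S - p j := by field_simp
      linarith
  have hsum := Finset.sum_le_sum fun j (_ : j ∈ Finset.univ) => hterm j
  simp only [Finset.sum_sub_distrib, ← Finset.sum_mul, ← Finset.sum_div, hp1, ← hS',
    div_self hS.ne'] at hsum
  linarith

/-- A family of entropic uncertainty relations, one for each value of the classical register,
yields an information exclusion relation. -/
lemma mutualInfo_add_le {J K Y : Type*} [Fintype J] [Fintype K] [Fintype Y]
    {P : J → Y → ℝ} {Q : K → Y → ℝ} {r : Y → ℝ} {h : J → ℝ}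
    (hP : ∀ j y, 0 ≤ P j y) (hQ : ∀ k y, 0 ≤ Q k y) (hh : ∀ j, 0 ≤ h j)
    (hPr : ∀ y, ∑ j, P j y = r y) (hQr : ∀ y, ∑ k, Q k y = r y) (hr : ∑ y, r y = 1)
    (hhP : ∀ j, h j = 0 → ∀ y, P j y = 0)
    (H : ∀ y, ∑ j, P j y * Real.log (P j y) + ∑ k, Q k y * Real.log (Q k y) -
      2 * (r y * Real.log (r y)) ≤ ∑ j, P j y * Real.log (h j)) :
    mutualInfo P + mutualInfo Q ≤ Real.logb 2 (Fintype.card K * ∑ j, h j) := by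
  obtain ⟨hS, h1⟩ := sum_mul_log_sub_le (p := fun j => ∑ y, P j y) (h := h)
    (fun j => Finset.sum_nonneg fun y _ => hP j y) hh
    (by rw [Finset.sum_comm]; simp only [hPr, hr])
    (fun j hj => Finset.sum_eq_zero fun y _ => hhP j hj y)
  obtain ⟨hK, h2⟩ := sum_mul_log_sub_le (p := fun k => ∑ y, Q k y) (h := fun _ : K => 1)
    (fun k => Finset.sum_nonneg fun y _ => hQ k y) (fun _ => zero_le_one)
    (by rw [Finset.sum_comm]; simp only [hQr, hr])
    (fun k hk => absurd hk one_ne_zero)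
  simp only [Finset.sum_const, Finset.card_univ, nsmul_eq_mul, mul_one, Real.log_one, mul_zero,
    zero_sub] at hK h2
  have h3 := Finset.sum_le_sum fun y (_ : y ∈ Finset.univ) => H y
  rw [Finset.sum_comm (f := fun y j => P j y * Real.log (h j))] at h3
  simp only [Finset.sum_sub_distrib, Finset.sum_add_distrib, ← Finset.mul_sum,
    ← Finset.sum_mul] at h3
  rw [mutualInfo_eq hP hPr, mutualInfo_eq hQ hQr, ← add_div, Real.logb,
    Real.log_mul hK.ne' hS.ne']
  refine div_le_div_of_nonneg_right ?_ (Real.log_nonneg one_le_two)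
  linarith

end Classical

open Matrix in
/-- Entropic uncertainty relation for a subnormalised state. -/
lemma sum_mul_log_add_le {n : ℕ} {J K : Type*} [Fintype J] [Fintype K]
    {X : J → Matrix (Fin n) (Fin n) ℂ} {Z : K → Matrix (Fin n) (Fin n) ℂ}
    (hX : ∀ j, (X j).PosSemidef) (hX1 : ∑ j, X j = 1)
    (hZ : ∀ k, (Z k).PosSemidef) (hZ1 : ∑ k, Z k = 1)
    {σ : Matrix (Fin n) (Fin n) ℂ} (hσ : σ.PosSemidef) {r : ℝ} (hr : σ.trace.re = r) :
    (∀ j, opNorm (∑ k, Z k * X j * Z k) = 0 → reTrace σ (X j) = 0) ∧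
    ∑ j, reTrace σ (X j) * Real.log (reTrace σ (X j)) +
      ∑ k, reTrace σ (Z k) * Real.log (reTrace σ (Z k)) - 2 * (r * Real.log r) ≤
      ∑ j, reTrace σ (X j) * Real.log (opNorm (∑ k, Z k * X j * Z k)) := by
  have hP0 : ∀ j, 0 ≤ reTrace σ (X j) := fun j => reTrace_nonneg hσ (hX j)
  have hQ0 : ∀ k, 0 ≤ reTrace σ (Z k) := fun k => reTrace_nonneg hσ (hZ k)
  have hPr : ∑ j, reTrace σ (X j) = r := (sum_reTrace_eq_trace hX1).trans hr
  have hQr : ∑ k, reTrace σ (Z k) = r := (sum_reTrace_eq_trace hZ1).trans hr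
  rcases eq_or_ne r 0 with h0 | h0
  · rw [h0] at hPr hQr
    have hP := (Finset.sum_eq_zero_iff_of_nonneg fun j _ => hP0 j).mp hPr
    have hQ := (Finset.sum_eq_zero_iff_of_nonneg fun k _ => hQ0 k).mp hQr
    simp only [Finset.mem_univ, true_imp_iff] at hP hQ
    simp [hP, hQ, h0]
  have hr0 : 0 < r := lt_of_le_of_ne (hPr ▸ Finset.sum_nonneg fun j _ => hP0 j) h0.symm
  set τ := r⁻¹ • σ with hτ
  have hτp : τ.PosSemidef := hσ.smul (inv_nonneg.mpr hr0.le)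
  have hτ1 : τ.trace.re = 1 := by simp [hτ, hr, h0]
  have hστ : ∀ M, reTrace σ M = r * reTrace τ M := fun M => by
    rw [hτ, reTrace_smul_left, mul_inv_cancel_left₀ h0]
  have hp0 : ∀ j, 0 ≤ reTrace τ (X j) := fun j => reTrace_nonneg hτp (hX j)
  have hq0 : ∀ k, 0 ≤ reTrace τ (Z k) := fun k => reTrace_nonneg hτp (hZ k)
  have hp1 : ∑ j, reTrace τ (X j) = 1 := (sum_reTrace_eq_trace hX1).trans hτ1
  have hq1 : ∑ k, reTrace τ (Z k) = 1 := (sum_reTrace_eq_trace hZ1).trans hτ1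
  have H := fun t (ht : (0 : ℝ) < t) => sum_sq_div_le_sum_div hτp hτ1 hX hX1 hZ hZ1 ht
  refine ⟨fun j hj => ?_, ?_⟩
  · rw [hστ, eq_zero_of_resolvent hp0 (fun _ => opNorm_nonneg _) hq0 H j hj, mul_zero]
  have hle := sum_mul_log_le_of_resolvent hp0 (fun _ => opNorm_nonneg _) hq0 hp1 hq1 H
  have hlog : ∀ x : ℝ, r * x * Real.log (r * x) = r * Real.log r * x + r * (x * Real.log x) := by
    intro x
    rcases eq_or_ne x 0 with hx | hx
    · simp [hx]
    · rw [Real.log_mul h0 hx]; ring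
  simp only [hστ, hlog, Finset.sum_add_distrib, mul_assoc r, ← Finset.mul_sum, hp1, hq1]
  linarith [mul_le_mul_of_nonneg_left hle hr0.le]

open Matrix in
lemma mutualInfo_add_mutualInfo_le {n : ℕ} {J K Y : Type*} [Fintype J] [Fintype K] [Fintype Y]
    {X : J → Matrix (Fin n) (Fin n) ℂ} {Z : K → Matrix (Fin n) (Fin n) ℂ}
    (hX : ∀ j, (X j).PosSemidef) (hX1 : ∑ j, X j = 1)
    (hZ : ∀ k, (Z k).PosSemidef) (hZ1 : ∑ k, Z k = 1)
    {ρ : Y → Matrix (Fin n) (Fin n) ℂ} (hρ : ∀ y, (ρ y).PosSemidef)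
    (htr : ∑ y, (ρ y).trace = 1) :
    mutualInfo (fun j y => (X j * ρ y).trace.re) + mutualInfo (fun k y => (Z k * ρ y).trace.re) ≤
      Real.logb 2 (Fintype.card K * ∑ j, opNorm (∑ k, Z k * X j * Z k)) := by
  have huncert := fun y => sum_mul_log_add_le hX hX1 hZ hZ1 (hρ y) rfl
  refine mutualInfo_add_le (r := fun y => (ρ y).trace.re)
    (fun j y => reTrace_nonneg (hρ y) (hX j)) (fun k y => reTrace_nonneg (hρ y) (hZ k))
    (fun j => opNorm_nonneg _) (fun y => sum_reTrace_eq_trace hX1)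
    (fun y => sum_reTrace_eq_trace hZ1) ?_ (fun j hj y => (huncert y).1 j hj)
    (fun y => (huncert y).2)
  rw [← Complex.re_sum, htr, Complex.one_re]

/-- Information exclusion relation for POVMs: for POVMs `{X_j}`, `{Z_k}` on `ℂ^n`, a finite
classical register `Y` with subnormalized states `{ρ^y}` of total trace one, joint
distributions `P^X(j,y) = Tr(X_j ρ^y)`, `P^Z(k,y) = Tr(Z_k ρ^y)`, and
`h_j(X,Z) = ‖∑ k, Z k X j Z k‖`, `h_k(Z,X) = ‖∑ j, X j Z k X j‖`:
`I(X:Y) + I(Z:Y) ≤ min {log₂(|K| ∑_j h_j(X,Z)), log₂(|J| ∑_k h_k(Z,X))}`. -/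
theorem stmt_13 {n : ℕ} {J K : Type*} [Fintype J] [Nonempty J] [Fintype K] [Nonempty K]
    {Y : Type*} [Fintype Y] [Nonempty Y]
    (X : J → Matrix (Fin n) (Fin n) ℂ) (Z : K → Matrix (Fin n) (Fin n) ℂ)
    (hXpsd : ∀ j, (X j).PosSemidef) (hXsum : ∑ j, X j = 1)
    (hZpsd : ∀ k, (Z k).PosSemidef) (hZsum : ∑ k, Z k = 1)
    (ρ : Y → Matrix (Fin n) (Fin n) ℂ) (hρ : ∀ y, (ρ y).PosSemidef)
    (htr : ∑ y, (ρ y).trace = 1) :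
    mutualInfo (fun j y => (X j * ρ y).trace.re) +
        mutualInfo (fun k y => (Z k * ρ y).trace.re) ≤
      min (Real.logb 2 (Fintype.card K * ∑ j, opNorm (∑ k, Z k * X j * Z k)))
          (Real.logb 2 (Fintype.card J * ∑ k, opNorm (∑ j, X j * Z k * X j))) := by
  refine le_min (mutualInfo_add_mutualInfo_le hXpsd hXsum hZpsd hZsum hρ htr) ?_
  rw [add_comm]
  exact mutualInfo_add_mutualInfo_le hZpsd hZsum hXpsd hXsum hρ htr
end
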